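/- arXiv:math/0306074 — 12 statements merged into one kernel-verified Lean document; each statement's English description precedes it below -/
import Mathlib

section
/- Let α_1,…,α_n be complex numbers and A_1,…,A_n bounded linear operators on a complex Hilbert space H. Then ‖∑_{i=1}^n α_i A_i‖² ≤ ∑_{i=1}^n |α_i|² ‖A_i‖² + ∑_{1≤ i≠ j ≤ n} |α_i||α_j| ‖A_i A_j*‖. -/
/-- `‖∑ α_i A_i‖² ≤ ∑ |α_i|²‖A_i‖² + ∑_{i≠j} |α_i||α_j|‖A_i A_j*‖`. -/
theorem stmt_3 {H : Type*} [NormedAddCommGroup H] [InnerProductSpace ℂ H] [CompleteSpace H]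
    (n : ℕ) (α : Fin n → ℂ) (A : Fin n → H →L[ℂ] H) :
    ‖∑ i, α i • A i‖ ^ 2 ≤
      ∑ i, ‖α i‖ ^ 2 * ‖A i‖ ^ 2 +
        ∑ p ∈ Finset.univ.offDiag,
          ‖α p.1‖ * ‖α p.2‖ * ‖A p.1 * ContinuousLinearMap.adjoint (A p.2)‖ := by
  have key : ∀ i j, ‖(α i • A i) * star (α j • A j)‖
      = ‖α i‖ * ‖α j‖ * ‖A i * ContinuousLinearMap.adjoint (A j)‖ := by
    intro i j
    rw [star_smul, smul_mul_assoc, mul_smul_comm, norm_smul, norm_smul, norm_star, mul_assoc,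
      ContinuousLinearMap.star_eq_adjoint]
  have diag : ∑ i, ‖α i‖ ^ 2 * ‖A i‖ ^ 2 = ∑ p ∈ (Finset.univ : Finset (Fin n)).diag,
      ‖α p.1‖ * ‖α p.2‖ * ‖A p.1 * ContinuousLinearMap.adjoint (A p.2)‖ := by
    rw [Finset.sum_diag]
    refine Finset.sum_congr rfl fun i _ => ?_
    rw [← ContinuousLinearMap.star_eq_adjoint, CStarRing.norm_self_mul_star]
    ring
  rw [diag, ← Finset.sum_union (Finset.disjoint_diag_offDiag _), Finset.diag_union_offDiag,
    Finset.sum_product, sq, ← CStarRing.norm_self_mul_star, star_sum, Finset.sum_mul_sum]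
  refine (norm_sum_le _ _).trans (Finset.sum_le_sum fun i _ => (norm_sum_le _ _).trans
    (Finset.sum_le_sum fun j _ => (key i j).le))
end

section
/- Let α_1,…,α_n be complex numbers and A_1,…,A_n bounded linear operators on a complex Hilbert space H. Then ‖∑_{i=1}^n α_i A_i‖² ≤ (max_{1≤i≤n} |α_i|²) · ∑_{i=1}^n ‖A_i‖² + (max_{1≤ i≠ j ≤ n} |α_i||α_j|) · ∑_{1≤ i≠ j ≤ n} ‖A_i A_j*‖. -/
/-- `‖∑ α_i A_i‖² ≤ (max_i |α_i|²) ∑ ‖A_i‖² + (max_{i≠j} |α_i||α_j|) ∑_{i≠j} ‖A_i A_j*‖`. -/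
theorem stmt_4 {H : Type*} [NormedAddCommGroup H] [InnerProductSpace ℂ H] [CompleteSpace H]
    (n : ℕ) (hn : 1 < n) (α : Fin n → ℂ) (A : Fin n → H →L[ℂ] H) :
    ‖∑ i, α i • A i‖ ^ 2 ≤
      (⨆ i, ‖α i‖ ^ 2) * ∑ i, ‖A i‖ ^ 2 +
        (⨆ p : {p : Fin n × Fin n // p.1 ≠ p.2}, ‖α p.1.1‖ * ‖α p.1.2‖) *
          ∑ p ∈ Finset.univ.offDiag, ‖A p.1 * ContinuousLinearMap.adjoint (A p.2)‖ := by
  have h1 : ‖∑ i, α i • A i‖ ^ 2 ≤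
      ∑ p : Fin n × Fin n, ‖α p.1‖ * ‖α p.2‖ * ‖A p.1 * star (A p.2)‖ := by
    rw [sq, ← CStarRing.norm_self_mul_star, star_sum, Finset.sum_mul_sum,
      ← Finset.sum_product', Finset.univ_product_univ]
    refine (norm_sum_le _ _).trans (Finset.sum_le_sum fun p _ => ?_)
    rw [star_smul, smul_mul_smul_comm, norm_smul, norm_mul, norm_star]
  refine h1.trans ?_
  rw [← Finset.univ_product_univ, ← Finset.diag_union_offDiag,
    Finset.sum_union (Finset.disjoint_diag_offDiag _), Finset.sum_diag,
    Finset.mul_sum, Finset.mul_sum]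
  refine add_le_add (Finset.sum_le_sum fun i _ => ?_) (Finset.sum_le_sum fun p hp => ?_)
  · rw [CStarRing.norm_self_mul_star, ← sq, ← sq]
    exact mul_le_mul_of_nonneg_right
      (le_ciSup (f := fun i => ‖α i‖ ^ 2) (Set.finite_range _).bddAbove i) (by positivity)
  · refine mul_le_mul_of_nonneg_right ?_ (norm_nonneg _)
    exact le_ciSup (f := fun p : {p : Fin n × Fin n // p.1 ≠ p.2} => ‖α p.1.1‖ * ‖α p.1.2‖)
      (Set.finite_range _).bddAbove ⟨p, (Finset.mem_offDiag.mp hp).2.2⟩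
end

section
/- Let α_1,…,α_n be complex numbers, A_1,…,A_n bounded linear operators on a complex Hilbert space H, and let p, q, r, s > 1 with 1/p + 1/q = 1 and 1/r + 1/s = 1. Then ‖∑_{i=1}^n α_i A_i‖² ≤ (∑_{i=1}^n |α_i|^{2p})^{1/p} (∑_{i=1}^n ‖A_i‖^{2q})^{1/q} + [(∑_{i=1}^n |α_i|^r)² − ∑_{i=1}^n |α_i|^{2r}]^{1/r} · (∑_{1≤ i≠ j ≤ n} ‖A_i A_j*‖^s)^{1/s}. -/
/-- Hölder-type bound:
`‖∑ α_i A_i‖² ≤ (∑|α_i|^{2p})^{1/p} (∑‖A_i‖^{2q})^{1/q}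
  + [(∑|α_i|^r)² − ∑|α_i|^{2r}]^{1/r} (∑_{i≠j}‖A_i A_j*‖^s)^{1/s}`. -/
theorem stmt_5 {H : Type*} [NormedAddCommGroup H] [InnerProductSpace ℂ H] [CompleteSpace H]
    (n : ℕ) (α : Fin n → ℂ) (A : Fin n → H →L[ℂ] H) (p q r s : ℝ)
    (hp : 1 < p) (hq : 1 < q) (hr : 1 < r) (hs : 1 < s)
    (hpq : 1 / p + 1 / q = 1) (hrs : 1 / r + 1 / s = 1) :
    ‖∑ i, α i • A i‖ ^ 2 ≤
      (∑ i, ‖α i‖ ^ (2 * p)) ^ (1 / p) * (∑ i, ‖A i‖ ^ (2 * q)) ^ (1 / q) +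
        ((∑ i, ‖α i‖ ^ r) ^ 2 - ∑ i, ‖α i‖ ^ (2 * r)) ^ (1 / r) *
          (∑ p ∈ Finset.univ.offDiag,
              ‖A p.1 * ContinuousLinearMap.adjoint (A p.2)‖ ^ s) ^ (1 / s) := by
  have hpq' : p.HolderConjugate q := by
    rw [Real.holderConjugate_iff]; exact ⟨hp, by simpa [one_div] using hpq⟩
  have hrs' : r.HolderConjugate s := by
    rw [Real.holderConjugate_iff]; exact ⟨hr, by simpa [one_div] using hrs⟩
  have key : ∀ f : Fin n × Fin n → ℝ, ∑ i, ∑ j, f (i, j) =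
      ∑ i, f (i, i) + ∑ x ∈ (Finset.univ : Finset (Fin n)).offDiag, f x := by
    intro f
    rw [← Finset.sum_product', ← Finset.diag_union_offDiag,
      Finset.sum_union (Finset.disjoint_diag_offDiag _), Finset.sum_diag]
  have h1 : ‖∑ i, α i • A i‖ ^ 2 ≤ ∑ i, ∑ j, ‖α i‖ * ‖α j‖ *
      ‖A i * ContinuousLinearMap.adjoint (A j)‖ := by
    rw [pow_two, ← CStarRing.norm_self_mul_star, star_sum, Finset.sum_mul_sum]
    refine (norm_sum_le _ _).trans (Finset.sum_le_sum fun i _ => ?_)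
    refine (norm_sum_le _ _).trans (Finset.sum_le_sum fun j _ => ?_)
    rw [star_smul, smul_mul_smul_comm, norm_smul, norm_mul, norm_star,
      ContinuousLinearMap.star_eq_adjoint]
  rw [key (fun x => ‖α x.1‖ * ‖α x.2‖ * ‖A x.1 * ContinuousLinearMap.adjoint (A x.2)‖)] at h1
  refine h1.trans (add_le_add ?_ ?_)
  · have h := Real.inner_le_Lp_mul_Lq_of_nonneg Finset.univ hpq'
      (f := fun i => ‖α i‖ ^ (2 : ℝ)) (g := fun i => ‖A i‖ ^ (2 : ℝ))
      (fun i _ => by positivity) (fun i _ => by positivity)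
    simp only [← Real.rpow_mul (norm_nonneg _)] at h
    refine le_trans (le_of_eq (Finset.sum_congr rfl fun i _ => ?_)) h
    simp only
    rw [← ContinuousLinearMap.star_eq_adjoint, CStarRing.norm_self_mul_star,
      Real.rpow_two, Real.rpow_two]
    ring
  · have h := Real.inner_le_Lp_mul_Lq_of_nonneg (Finset.univ : Finset (Fin n)).offDiag hrs'
      (f := fun x => ‖α x.1‖ * ‖α x.2‖)
      (g := fun x => ‖A x.1 * ContinuousLinearMap.adjoint (A x.2)‖)
      (fun i _ => by positivity) (fun i _ => by positivity)
    have e : (∑ i, ‖α i‖ ^ r) ^ 2 - ∑ i, ‖α i‖ ^ (2 * r) =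
        ∑ x ∈ (Finset.univ : Finset (Fin n)).offDiag, (‖α x.1‖ * ‖α x.2‖) ^ r := by
      have k := key (fun x => (‖α x.1‖ * ‖α x.2‖) ^ r)
      have d : ∀ i, ‖α i‖ ^ (2 * r) = (‖α i‖ * ‖α i‖) ^ r := fun i => by
        rw [Real.rpow_mul (norm_nonneg _), Real.rpow_two, pow_two]
      rw [pow_two, Finset.sum_mul_sum, sub_eq_iff_eq_add', Finset.sum_congr rfl fun i _ => d i,
        ← k]
      exact Finset.sum_congr rfl fun i _ => Finset.sum_congr rfl fun j _ =>
        (Real.mul_rpow (norm_nonneg _) (norm_nonneg _)).symm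
    rw [e]
    exact h
end

section
/- Let α_1,…,α_n be complex numbers and A_1,…,A_n bounded linear operators on a complex Hilbert space H. Then ‖∑_{i=1}^n α_i A_i‖² ≤ (∑_{i=1}^n |α_i|²) · max_{1≤i≤n} ‖A_i‖² + [(∑_{i=1}^n |α_i|)² − ∑_{i=1}^n |α_i|²] · max_{1≤ i≠ j ≤ n} ‖A_i A_j*‖. -/
/-- `‖∑ α_i A_i‖² ≤ (∑|α_i|²) max_i ‖A_i‖² + [(∑|α_i|)² − ∑|α_i|²] max_{i≠j} ‖A_i A_j*‖`. -/
theorem stmt_6 {H : Type*} [NormedAddCommGroup H] [InnerProductSpace ℂ H] [CompleteSpace H]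
    (n : ℕ) (hn : 1 < n) (α : Fin n → ℂ) (A : Fin n → H →L[ℂ] H) :
    ‖∑ i, α i • A i‖ ^ 2 ≤
      (∑ i, ‖α i‖ ^ 2) * (⨆ i, ‖A i‖ ^ 2) +
        ((∑ i, ‖α i‖) ^ 2 - ∑ i, ‖α i‖ ^ 2) *
          (⨆ p : {p : Fin n × Fin n // p.1 ≠ p.2},
            ‖A p.1.1 * ContinuousLinearMap.adjoint (A p.1.2)‖) := by
  set M := ⨆ i, ‖A i‖ ^ 2 with hM
  set K := ⨆ p : {p : Fin n × Fin n // p.1 ≠ p.2},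
            ‖A p.1.1 * ContinuousLinearMap.adjoint (A p.1.2)‖ with hK
  have h1 : ∀ i, ‖A i‖ ^ 2 ≤ M := fun i =>
    le_ciSup (f := fun i => ‖A i‖ ^ 2) (Set.finite_range _).bddAbove i
  have h2 : ∀ i j, i ≠ j → ‖A i * star (A j)‖ ≤ K := fun i j hij =>
    le_ciSup (f := fun p : {p : Fin n × Fin n // p.1 ≠ p.2} =>
      ‖A p.1.1 * ContinuousLinearMap.adjoint (A p.1.2)‖) (Set.finite_range _).bddAbove
      ⟨(i, j), hij⟩
  have h3 : ∀ i j, ‖A i * star (A j)‖ ≤ K + (if i = j then M - K else 0) := by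
    intro i j
    by_cases hij : i = j
    · subst hij
      rw [CStarRing.norm_self_mul_star, ← sq]
      simpa using h1 i
    · simpa [hij] using h2 i j hij
  calc ‖∑ i, α i • A i‖ ^ 2 = ‖(∑ i, α i • A i) * star (∑ i, α i • A i)‖ := by
        rw [CStarRing.norm_self_mul_star, sq]
    _ = ‖∑ i, ∑ j, (α i * star (α j)) • (A i * star (A j))‖ := by
        rw [star_sum, Finset.sum_mul_sum]
        simp only [star_smul, smul_mul_smul_comm]
    _ ≤ ∑ i, ∑ j, ‖(α i * star (α j)) • (A i * star (A j))‖ :=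
        (norm_sum_le _ _).trans (Finset.sum_le_sum fun i _ => norm_sum_le _ _)
    _ ≤ ∑ i, ∑ j, (‖α i‖ * ‖α j‖) * (K + (if i = j then M - K else 0)) := by
        refine Finset.sum_le_sum fun i _ => Finset.sum_le_sum fun j _ => ?_
        rw [norm_smul, norm_mul, norm_star]
        exact mul_le_mul_of_nonneg_left (h3 i j) (by positivity)
    _ = (∑ i, ‖α i‖) ^ 2 * K + (∑ i, ‖α i‖ ^ 2) * (M - K) := by
        simp only [mul_add, Finset.sum_add_distrib, mul_ite, mul_zero, Finset.sum_ite_eq,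
          Finset.mem_univ, if_true, ← Finset.sum_mul]
        rw [sq (∑ i, ‖α i‖), Finset.sum_mul_sum]
        simp only [sq]
    _ = _ := by ring
end

section
/- Let α_1,…,α_n be complex numbers and A_1,…,A_n bounded linear operators on a complex Hilbert space H. Then ‖∑_{i=1}^n α_i A_i‖ ≤ (max_{1≤i≤n} |α_i|) · (∑_{i,j=1}^n ‖A_i A_j*‖)^{1/2}. -/
/-- `‖∑ α_i A_i‖ ≤ (max_i |α_i|) (∑_{i,j} ‖A_i A_j*‖)^{1/2}`. -/
theorem stmt_7 {H : Type*} [NormedAddCommGroup H] [InnerProductSpace ℂ H] [CompleteSpace H]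
    (n : ℕ) (hn : 0 < n) (α : Fin n → ℂ) (A : Fin n → H →L[ℂ] H) :
    ‖∑ i, α i • A i‖ ≤
      (⨆ i, ‖α i‖) *
        Real.sqrt (∑ i, ∑ j, ‖A i * ContinuousLinearMap.adjoint (A j)‖) := by
  have hle : ∀ i, ‖α i‖ ≤ ⨆ i, ‖α i‖ := fun i =>
    le_ciSup (f := fun i => ‖α i‖) (Set.finite_range _).bddAbove i
  have hM : 0 ≤ ⨆ i, ‖α i‖ := (norm_nonneg _).trans (hle ⟨0, hn⟩)
  generalize (⨆ i, ‖α i‖) = M at hle hM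
  have hS : 0 ≤ ∑ i, ∑ j, ‖A i * ContinuousLinearMap.adjoint (A j)‖ :=
    Finset.sum_nonneg fun i _ => Finset.sum_nonneg fun j _ => norm_nonneg _
  refine le_trans (le_abs_self _) (abs_le_of_sq_le_sq ?_ (mul_nonneg hM (Real.sqrt_nonneg _)))
  rw [mul_pow, Real.sq_sqrt hS, sq, ← CStarRing.norm_self_mul_star, star_sum,
    Finset.sum_mul_sum, Finset.mul_sum]
  refine (norm_sum_le _ _).trans (Finset.sum_le_sum fun i _ => ?_)
  rw [Finset.mul_sum]
  refine (norm_sum_le _ _).trans (Finset.sum_le_sum fun j _ => ?_)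
  rw [star_smul, smul_mul_smul_comm, norm_smul, norm_mul, norm_star,
    ContinuousLinearMap.star_eq_adjoint, sq]
  exact mul_le_mul_of_nonneg_right
    (mul_le_mul (hle i) (hle j) (norm_nonneg _) hM) (norm_nonneg _)
end

section
/- Let α_1,…,α_n be complex numbers, A_1,…,A_n bounded linear operators on a complex Hilbert space H, and p > 1 with 1/p + 1/q = 1. Then ‖∑_{i=1}^n α_i A_i‖² ≤ (∑_{i=1}^n |α_i|^{2p})^{1/p} · [ (∑_{i=1}^n ‖A_i‖^{2q})^{1/q} + (n−1)(∑_{1≤ i≠ j ≤ n} ‖A_i A_j*‖^q)^{1/q} ]. -/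
theorem sum_split_aux (n : ℕ) (f : Fin n → Fin n → ℝ) :
    ∑ i, ∑ j, f i j = ∑ i, f i i + ∑ x ∈ (Finset.univ : Finset (Fin n)).offDiag, f x.1 x.2 := by
  rw [← Finset.sum_product' Finset.univ Finset.univ f, ← Finset.diag_union_offDiag,
    Finset.sum_union (Finset.disjoint_diag_offDiag _)]
  simp [Finset.sum_diag]

theorem norm_sq_aux {H : Type*} [NormedAddCommGroup H] [InnerProductSpace ℂ H] [CompleteSpace H]
    (n : ℕ) (α : Fin n → ℂ) (A : Fin n → H →L[ℂ] H) :
    ‖∑ i, α i • A i‖ ^ 2 ≤ ∑ i, ∑ j, ‖α i‖ * ‖α j‖ *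
      ‖A i * ContinuousLinearMap.adjoint (A j)‖ := by
  rw [pow_two, ← CStarRing.norm_self_mul_star, star_sum, Finset.sum_mul_sum]
  refine (norm_sum_le _ _).trans (Finset.sum_le_sum fun i _ => ?_)
  refine (norm_sum_le _ _).trans (Finset.sum_le_sum fun j _ => ?_)
  rw [star_smul, smul_mul_smul_comm, norm_smul, norm_mul, norm_star,
    ContinuousLinearMap.star_eq_adjoint]

theorem offdiag_aux (n : ℕ) (a : Fin n → ℝ) :
    ∑ x ∈ (Finset.univ : Finset (Fin n)).offDiag, a x.1 * a x.2 ≤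
      ((n : ℝ) - 1) * ∑ i, a i ^ 2 := by
  have h1 := sum_split_aux n (fun i j => a i * a j)
  have h2 := sq_sum_le_card_mul_sum_sq (s := (Finset.univ : Finset (Fin n))) (f := a)
  rw [← Finset.sum_mul_sum, ← pow_two] at h1
  simp only [Finset.card_univ, Fintype.card_fin, ← pow_two] at h1 h2
  linarith

/-- `‖∑ α_i A_i‖² ≤ (∑|α_i|^{2p})^{1/p} [(∑‖A_i‖^{2q})^{1/q}
  + (n−1)(∑_{i≠j}‖A_i A_j*‖^q)^{1/q}]` for conjugate exponents `p, q`. -/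
theorem stmt_8 {H : Type*} [NormedAddCommGroup H] [InnerProductSpace ℂ H] [CompleteSpace H]
    (n : ℕ) (α : Fin n → ℂ) (A : Fin n → H →L[ℂ] H) (p q : ℝ)
    (hp : 1 < p) (hpq : 1 / p + 1 / q = 1) :
    ‖∑ i, α i • A i‖ ^ 2 ≤
      (∑ i, ‖α i‖ ^ (2 * p)) ^ (1 / p) *
        ((∑ i, ‖A i‖ ^ (2 * q)) ^ (1 / q) +
          ((n : ℝ) - 1) *
            (∑ p ∈ Finset.univ.offDiag,
                ‖A p.1 * ContinuousLinearMap.adjoint (A p.2)‖ ^ q) ^ (1 / q)) := by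
  have hp0 : 0 < p := by linarith
  have hq0 : 0 < 1 / q := by
    have : 1 / p < 1 := by rw [div_lt_one hp0]; exact hp
    linarith
  have hq : 0 < q := one_div_pos.mp hq0
  have hH : p.HolderConjugate q := by
    rw [Real.holderConjugate_iff]
    exact ⟨hp, by simpa using hpq⟩
  rcases Nat.eq_zero_or_pos n with rfl | hn
  · simp [hp0.ne', hq.ne']
  have hn1 : (1 : ℝ) ≤ n := by exact_mod_cast hn
  refine (norm_sq_aux n α A).trans ?_
  rw [sum_split_aux n (fun i j => ‖α i‖ * ‖α j‖ * ‖A i * ContinuousLinearMap.adjoint (A j)‖),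
    mul_add]
  refine add_le_add ?_ ?_
  · have h := Real.inner_le_Lp_mul_Lq_of_nonneg (Finset.univ : Finset (Fin n)) hH
      (f := fun i => ‖α i‖ ^ (2 : ℝ)) (g := fun i => ‖A i‖ ^ (2 : ℝ))
      (fun i _ => by positivity) (fun i _ => by positivity)
    simp only [← Real.rpow_mul (norm_nonneg _)] at h
    refine le_trans (le_of_eq (Finset.sum_congr rfl fun i _ => ?_)) h
    rw [← ContinuousLinearMap.star_eq_adjoint, CStarRing.norm_self_mul_star, Real.rpow_two,
      Real.rpow_two]
    ring
  · have h := Real.inner_le_Lp_mul_Lq_of_nonneg (Finset.univ : Finset (Fin n)).offDiag hH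
      (f := fun x => ‖α x.1‖ * ‖α x.2‖)
      (g := fun x => ‖A x.1 * ContinuousLinearMap.adjoint (A x.2)‖)
      (fun i _ => by positivity) (fun i _ => by positivity)
    refine h.trans ?_
    rw [← mul_assoc]
    rcases Nat.lt_or_ge n 2 with h2 | h2
    · obtain rfl : n = 1 := by omega
      have : (Finset.univ : Finset (Fin 1)).offDiag = ∅ := by decide
      simp [this, hp0.ne', hq.ne']
    refine mul_le_mul_of_nonneg_right ?_ (by positivity)
    have hn2 : (1 : ℝ) ≤ (n : ℝ) - 1 := by
      have : (2 : ℝ) ≤ n := by exact_mod_cast h2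
      linarith
    have h3 := offdiag_aux n (fun i => ‖α i‖ ^ p)
    have h4 : ∀ i, (‖α i‖ ^ p) ^ 2 = ‖α i‖ ^ (2 * p) := fun i => by
      rw [← Real.rpow_two, ← Real.rpow_mul (norm_nonneg _), mul_comm]
    simp only [h4] at h3
    simp only [Real.mul_rpow (norm_nonneg _) (norm_nonneg _)]
    refine (Real.rpow_le_rpow (by positivity) h3 (by positivity)).trans ?_
    rw [Real.mul_rpow (by linarith) (by positivity), mul_comm]
    refine mul_le_mul_of_nonneg_left ?_ (by positivity)
    calc ((n : ℝ) - 1) ^ (1 / p) ≤ ((n : ℝ) - 1) ^ (1 : ℝ) :=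
          Real.rpow_le_rpow_of_exponent_le hn2 (by linarith)
      _ = (n : ℝ) - 1 := Real.rpow_one _
end

section
/- Let α_1,…,α_n be complex numbers and A_1,…,A_n bounded linear operators on a complex Hilbert space H. Then ‖∑_{i=1}^n α_i A_i‖² ≤ (∑_{i=1}^n |α_i|²) · [ max_{1≤i≤n} ‖A_i‖² + (n−1) · max_{1≤ i≠ j ≤ n} ‖A_i A_j*‖ ]. -/
/-- `‖∑ α_i A_i‖² ≤ (∑|α_i|²)[max_i ‖A_i‖² + (n−1) max_{i≠j} ‖A_i A_j*‖]`. -/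
theorem stmt_9 {H : Type*} [NormedAddCommGroup H] [InnerProductSpace ℂ H] [CompleteSpace H]
    (n : ℕ) (hn : 1 < n) (α : Fin n → ℂ) (A : Fin n → H →L[ℂ] H) :
    ‖∑ i, α i • A i‖ ^ 2 ≤
      (∑ i, ‖α i‖ ^ 2) *
        ((⨆ i, ‖A i‖ ^ 2) +
          ((n : ℝ) - 1) *
            (⨆ p : {p : Fin n × Fin n // p.1 ≠ p.2},
              ‖A p.1.1 * ContinuousLinearMap.adjoint (A p.1.2)‖)) := by
  set M : ℝ := ⨆ i, ‖A i‖ ^ 2 with hM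
  set K : ℝ := ⨆ p : {p : Fin n × Fin n // p.1 ≠ p.2},
              ‖A p.1.1 * ContinuousLinearMap.adjoint (A p.1.2)‖ with hK
  have hK0 : 0 ≤ K := Real.iSup_nonneg fun _ => norm_nonneg _
  have hc : ∀ i j, ‖A i * star (A j)‖ ≤ K + if i = j then M - K else 0 := by
    intro i j
    by_cases h : i = j
    · subst h
      have h1 : ‖A i‖ ^ 2 ≤ M :=
        le_ciSup (f := fun i => ‖A i‖ ^ 2) (Set.finite_range _).bddAbove i
      rw [CStarRing.norm_self_mul_star]
      simp only [if_true]
      nlinarith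
    · have h1 := le_ciSup (f := fun p : {p : Fin n × Fin n // p.1 ≠ p.2} =>
        ‖A p.1.1 * ContinuousLinearMap.adjoint (A p.1.2)‖)
        (Set.finite_range _).bddAbove ⟨(i, j), h⟩
      simp only [h, if_false, add_zero]
      exact h1
  have h2 : ‖∑ i, α i • A i‖ ^ 2 = ‖∑ i, ∑ j, (α i • A i) * star (α j • A j)‖ := by
    rw [sq, ← CStarRing.norm_self_mul_star, star_sum, Finset.sum_mul_sum]
  have h3 : ‖∑ i, ∑ j, (α i • A i) * star (α j • A j)‖ ≤
      ∑ i, ∑ j, ‖α i‖ * ‖α j‖ * (K + if i = j then M - K else 0) := by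
    refine (norm_sum_le _ _).trans (Finset.sum_le_sum fun i _ => ?_)
    refine (norm_sum_le _ _).trans (Finset.sum_le_sum fun j _ => ?_)
    rw [star_smul, smul_mul_smul_comm, norm_smul, norm_mul, norm_star]
    exact mul_le_mul_of_nonneg_left (hc i j) (by positivity)
  have h4 : ∑ i, ∑ j, ‖α i‖ * ‖α j‖ * (K + if i = j then M - K else 0) =
      K * (∑ i, ‖α i‖) ^ 2 + (∑ i, ‖α i‖ ^ 2) * (M - K) := by
    simp only [mul_add, Finset.sum_add_distrib, mul_ite, mul_zero, Finset.sum_ite_eq,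
      Finset.mem_univ, if_true]
    rw [sq, Finset.sum_mul_sum, Finset.mul_sum, Finset.sum_mul]
    congr 1
    · refine Finset.sum_congr rfl fun i _ => ?_
      rw [Finset.mul_sum]
      exact Finset.sum_congr rfl fun j _ => by ring
    · exact Finset.sum_congr rfl fun i _ => by ring
  have h5 : (∑ i, ‖α i‖) ^ 2 ≤ n * ∑ i, ‖α i‖ ^ 2 := by
    simpa using sq_sum_le_card_mul_sum_sq (s := Finset.univ) (f := fun i => ‖α i‖)
  have h6 := mul_le_mul_of_nonneg_left h5 hK0
  rw [h2]
  refine h3.trans ?_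
  rw [h4]
  linarith
end

section
/- Let α_1,…,α_n be complex numbers and A_1,…,A_n bounded linear operators on a complex Hilbert space H. Then ‖∑_{i=1}^n α_i A_i‖² ≤ (∑_{i=1}^n |α_i|²) · [ max_{1≤i≤n} ‖A_i‖² + (∑_{1≤ i≠ j ≤ n} ‖A_i A_j*‖²)^{1/2} ]. -/
/-- `‖∑ α_i A_i‖² ≤ (∑|α_i|²)[max_i ‖A_i‖² + (∑_{i≠j} ‖A_i A_j*‖²)^{1/2}]`. -/
theorem stmt_10 {H : Type*} [NormedAddCommGroup H] [InnerProductSpace ℂ H] [CompleteSpace H]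
    (n : ℕ) (hn : 0 < n) (α : Fin n → ℂ) (A : Fin n → H →L[ℂ] H) :
    ‖∑ i, α i • A i‖ ^ 2 ≤
      (∑ i, ‖α i‖ ^ 2) *
        ((⨆ i, ‖A i‖ ^ 2) +
          Real.sqrt (∑ p ∈ Finset.univ.offDiag,
            ‖A p.1 * ContinuousLinearMap.adjoint (A p.2)‖ ^ 2)) := by
  simp only [← ContinuousLinearMap.star_eq_adjoint]
  have h1 : ‖∑ i, α i • A i‖ ^ 2 ≤
      ∑ p ∈ (Finset.univ : Finset (Fin n)) ×ˢ (Finset.univ : Finset (Fin n)),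
        (‖α p.1‖ * ‖α p.2‖) * ‖A p.1 * star (A p.2)‖ := by
    rw [pow_two, ← CStarRing.norm_self_mul_star, star_sum, Finset.sum_mul_sum,
      ← Finset.sum_product']
    refine (norm_sum_le _ _).trans (Finset.sum_le_sum fun p _ => le_of_eq ?_)
    rw [star_smul, smul_mul_smul_comm, norm_smul, norm_mul, norm_star]
  rw [← Finset.diag_union_offDiag, Finset.sum_union (Finset.disjoint_diag_offDiag _),
    Finset.sum_diag] at h1
  refine h1.trans ?_
  rw [mul_add]
  refine add_le_add ?_ ?_
  · rw [Finset.sum_mul]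
    refine Finset.sum_le_sum fun i _ => ?_
    rw [CStarRing.norm_self_mul_star, ← pow_two, ← pow_two]
    exact mul_le_mul_of_nonneg_left
      (le_ciSup (f := fun i => ‖A i‖ ^ 2) (Set.finite_range _).bddAbove i) (by positivity)
  · refine (Real.sum_mul_le_sqrt_mul_sqrt _ _ _).trans ?_
    refine mul_le_mul_of_nonneg_right ?_ (Real.sqrt_nonneg _)
    refine Real.sqrt_le_iff.2 ⟨by positivity, ?_⟩
    rw [pow_two (∑ i, ‖α i‖ ^ 2), Finset.sum_mul_sum, ← Finset.sum_product']
    simp only [mul_pow]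
    refine Finset.sum_le_sum_of_subset_of_nonneg ?_ fun _ _ _ => by positivity
    intro p _
    simp
end

section
/- Let α_1,…,α_n be complex numbers and A_1,…,A_n bounded linear operators on a complex Hilbert space H. Then ‖∑_{i=1}^n α_i A_i‖² ≤ (∑_{i=1}^n |α_i|²) · [ max_{1≤i≤n} ‖A_i‖² + ∑_{1≤ i≠ j ≤ n} ‖A_i A_j*‖ ]. -/
/-- `‖∑ α_i A_i‖² ≤ (∑|α_i|²)[max_i ‖A_i‖² + ∑_{i≠j} ‖A_i A_j*‖]`. -/
theorem stmt_11 {H : Type*} [NormedAddCommGroup H] [InnerProductSpace ℂ H] [CompleteSpace H]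
    (n : ℕ) (hn : 0 < n) (α : Fin n → ℂ) (A : Fin n → H →L[ℂ] H) :
    ‖∑ i, α i • A i‖ ^ 2 ≤
      (∑ i, ‖α i‖ ^ 2) *
        ((⨆ i, ‖A i‖ ^ 2) +
          ∑ p ∈ Finset.univ.offDiag,
            ‖A p.1 * ContinuousLinearMap.adjoint (A p.2)‖) := by
  classical
  set T := ∑ i, α i • A i with hT
  have h1 : ‖T‖ ^ 2 = ‖T * star T‖ := by rw [CStarRing.norm_self_mul_star, sq]
  have h2 : T * star T = ∑ p ∈ (Finset.univ : Finset (Fin n)) ×ˢ Finset.univ,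
      (α p.1 • A p.1) * star (α p.2 • A p.2) := by
    rw [hT, star_sum, Finset.sum_mul_sum, Finset.sum_product]
  have h3 : ∀ i j, ‖(α i • A i) * star (α j • A j)‖ =
      ‖α i‖ * ‖α j‖ * ‖A i * star (A j)‖ := by
    intro i j
    rw [star_smul, smul_mul_smul_comm, norm_smul, norm_mul, norm_star]
  have hle : ∀ i, ‖α i‖ ^ 2 ≤ ∑ i, ‖α i‖ ^ 2 := fun i =>
    Finset.single_le_sum (f := fun i => ‖α i‖ ^ 2) (fun _ _ => sq_nonneg _) (Finset.mem_univ i)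
  rw [h1, h2]
  refine (norm_sum_le _ _).trans ?_
  simp only [h3]
  rw [← Finset.diag_union_offDiag, Finset.sum_union (Finset.disjoint_diag_offDiag _),
    Finset.sum_diag, mul_add]
  refine add_le_add ?_ ?_
  · rw [Finset.sum_mul]
    refine Finset.sum_le_sum fun i _ => ?_
    rw [CStarRing.norm_self_mul_star, ← sq, ← sq]
    exact mul_le_mul_of_nonneg_left
      (le_ciSup (f := fun i => ‖A i‖ ^ 2) (Set.finite_range _).bddAbove i) (sq_nonneg _)
  · rw [Finset.mul_sum]
    refine Finset.sum_le_sum fun p _ => ?_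
    rw [← ContinuousLinearMap.star_eq_adjoint]
    refine mul_le_mul_of_nonneg_right ?_ (norm_nonneg _)
    nlinarith [hle p.1, hle p.2, sq_nonneg (‖α p.1‖ - ‖α p.2‖)]
end

section
/- Let α_1,…,α_n be complex numbers, A_1,…,A_n bounded linear operators on a complex Hilbert space H, and let 1 < r ≤ 2 with 1/r + 1/s = 1. Then ‖∑_{i=1}^n α_i A_i‖² ≤ (∑_{i=1}^n |α_i|²) · [ max_{1≤i≤n} ‖A_i‖² + n^{2/r − 1} · (∑_{1≤ i≠ j ≤ n} ‖A_i A_j*‖^s)^{1/s} ]. -/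
/-- `‖∑ α_i A_i‖² ≤ (∑|α_i|²)[max_i ‖A_i‖² + n^{2/r−1}(∑_{i≠j}‖A_i A_j*‖^s)^{1/s}]`
for `1 < r ≤ 2`, `1/r + 1/s = 1`. -/
theorem stmt_12 {H : Type*} [NormedAddCommGroup H] [InnerProductSpace ℂ H] [CompleteSpace H]
    (n : ℕ) (hn : 0 < n) (α : Fin n → ℂ) (A : Fin n → H →L[ℂ] H) (r s : ℝ)
    (hr1 : 1 < r) (hr2 : r ≤ 2) (hrs : 1 / r + 1 / s = 1) :
    ‖∑ i, α i • A i‖ ^ 2 ≤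
      (∑ i, ‖α i‖ ^ 2) *
        ((⨆ i, ‖A i‖ ^ 2) +
          (n : ℝ) ^ (2 / r - 1) *
            (∑ p ∈ Finset.univ.offDiag,
                ‖A p.1 * ContinuousLinearMap.adjoint (A p.2)‖ ^ s) ^ (1 / s)) := by
  have hr0 : 0 < r := by linarith
  have hconj : r.HolderConjugate s := by
    rw [Real.holderConjugate_iff]
    exact ⟨hr1, by simpa only [one_div] using hrs⟩
  set B : Fin n × Fin n → ℝ := fun p => ‖A p.1 * ContinuousLinearMap.adjoint (A p.2)‖ with hB
  have hB0 : ∀ p, 0 ≤ B p := fun p => norm_nonneg _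
  have hnorm : ∀ T : H →L[ℂ] H, ‖T * ContinuousLinearMap.adjoint T‖ = ‖T‖ ^ 2 := by
    intro T
    rw [← ContinuousLinearMap.star_eq_adjoint, CStarRing.norm_self_mul_star, sq]
  have h1 : ‖∑ i, α i • A i‖ ^ 2 ≤ ∑ p : Fin n × Fin n, (‖α p.1‖ * ‖α p.2‖) * B p := by
    rw [← hnorm, map_sum, Finset.sum_mul_sum, ← Finset.sum_product']
    refine (norm_sum_le _ _).trans (le_of_eq ?_)
    refine Finset.sum_congr rfl fun p _ => ?_
    rw [← ContinuousLinearMap.star_eq_adjoint, star_smul, smul_mul_smul_comm, norm_smul, norm_mul,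
      norm_star]
    rfl
  have hdiag : ∑ p ∈ (Finset.univ : Finset (Fin n)).diag, (‖α p.1‖ * ‖α p.2‖) * B p
      ≤ (∑ i, ‖α i‖ ^ 2) * (⨆ i, ‖A i‖ ^ 2) := by
    rw [Finset.sum_diag, Finset.sum_mul]
    refine Finset.sum_le_sum fun i _ => ?_
    have : B (i, i) = ‖A i‖ ^ 2 := hnorm _
    rw [this, ← sq]
    exact mul_le_mul_of_nonneg_left
      (le_ciSup (f := fun i => ‖A i‖ ^ 2) (Set.finite_range _).bddAbove i) (by positivity)
  have hpow : (∑ p ∈ (Finset.univ : Finset (Fin n)).offDiag, (‖α p.1‖ * ‖α p.2‖) ^ r) ^ (1 / r)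
      ≤ (n : ℝ) ^ (2 / r - 1) * ∑ i, ‖α i‖ ^ 2 := by
    have e1 : ∑ p ∈ (Finset.univ : Finset (Fin n)).offDiag, (‖α p.1‖ * ‖α p.2‖) ^ r
        ≤ (∑ i, ‖α i‖ ^ r) ^ (2 : ℝ) := by
      rw [Real.rpow_two, sq, Finset.sum_mul_sum, ← Finset.sum_product']
      refine (Finset.sum_le_sum_of_subset_of_nonneg (Finset.subset_univ _)
        fun p _ _ => by positivity).trans (le_of_eq ?_)
      exact Finset.sum_congr rfl fun p _ => Real.mul_rpow (norm_nonneg _) (norm_nonneg _)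
    have e2 := Real.rpow_le_rpow (Finset.sum_nonneg fun p _ => by positivity) e1
      (show 0 ≤ 1 / r by positivity)
    refine e2.trans ?_
    rw [← Real.rpow_mul (Finset.sum_nonneg fun p _ => by positivity), mul_one_div]
    have e3 := Real.rpow_sum_le_const_mul_sum_rpow (Finset.univ : Finset (Fin n))
      (fun i => ‖α i‖ ^ r) (p := 2 / r) (by rw [le_div_iff₀ hr0]; linarith)
    have e4 : ∀ i, |‖α i‖ ^ r| = ‖α i‖ ^ r := fun i => abs_of_nonneg (by positivity)
    have e5 : ∀ i, (‖α i‖ ^ r) ^ (2 / r) = ‖α i‖ ^ 2 := fun i => by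
      rw [← Real.rpow_mul (norm_nonneg _), mul_div_cancel₀ _ hr0.ne', Real.rpow_two]
    simpa only [e4, e5, Finset.card_univ, Fintype.card_fin] using e3
  have hoff : ∑ p ∈ (Finset.univ : Finset (Fin n)).offDiag, (‖α p.1‖ * ‖α p.2‖) * B p
      ≤ ((n : ℝ) ^ (2 / r - 1) * ∑ i, ‖α i‖ ^ 2) *
        (∑ p ∈ Finset.univ.offDiag, B p ^ s) ^ (1 / s) := by
    refine (Real.inner_le_Lp_mul_Lq_of_nonneg _ hconj (fun p _ => by positivity)
      (fun p _ => hB0 p)).trans ?_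
    exact mul_le_mul_of_nonneg_right hpow
      (Real.rpow_nonneg (Finset.sum_nonneg fun p _ => Real.rpow_nonneg (hB0 p) _) _)
  have hsplit : ∑ p : Fin n × Fin n, (‖α p.1‖ * ‖α p.2‖) * B p
      = ∑ p ∈ (Finset.univ : Finset (Fin n)).diag, (‖α p.1‖ * ‖α p.2‖) * B p
      + ∑ p ∈ (Finset.univ : Finset (Fin n)).offDiag, (‖α p.1‖ * ‖α p.2‖) * B p := by
    rw [← Finset.sum_union (Finset.disjoint_diag_offDiag _), Finset.diag_union_offDiag,
      Finset.univ_product_univ]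
  calc _ ≤ _ := h1
    _ = _ := hsplit
    _ ≤ _ := add_le_add hdiag hoff
    _ = _ := by ring
end

section
/- Let α_1,…,α_n be complex numbers and A_1,…,A_n bounded linear operators on a complex Hilbert space H such that A_i A_j* = 0 for all i ≠ j. Then ‖∑_{i=1}^n α_i A_i‖ ≤ (max_{1≤i≤n} |α_i|) · (∑_{i=1}^n ‖A_i‖²)^{1/2}, and moreover ‖∑_{i=1}^n α_i A_i‖ ≤ (∑_{i=1}^n |α_i|^{2p})^{1/(2p)} (∑_{i=1}^n ‖A_i‖^{2q})^{1/(2q)} for any p > 1 with 1/p + 1/q = 1, and ‖∑_{i=1}^n α_i A_i‖ ≤ (∑_{i=1}^n |α_i|²)^{1/2} · max_{1≤i≤n} ‖A_i‖. -/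
theorem le_of_sq_le_sq_aux {a b : ℝ} (h : a ^ 2 ≤ b ^ 2) (hb : 0 ≤ b) : a ≤ b :=
  abs_le_of_sq_le_sq' h hb |>.2

theorem key_aux {H : Type*} [NormedAddCommGroup H] [InnerProductSpace ℂ H] [CompleteSpace H]
    (n : ℕ) (α : Fin n → ℂ) (A : Fin n → H →L[ℂ] H)
    (hA : ∀ i j, i ≠ j → A i * ContinuousLinearMap.adjoint (A j) = 0) :
    ‖∑ i, α i • A i‖ ^ 2 ≤ ∑ i, ‖α i‖ ^ 2 * ‖A i‖ ^ 2 := by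
  have h1 : (∑ i, α i • A i) * star (∑ i, α i • A i)
      = ∑ i, (α i • A i) * star (α i • A i) := by
    rw [star_sum, Finset.sum_mul_sum]
    refine Finset.sum_congr rfl fun i _ => ?_
    refine Finset.sum_eq_single i (fun j _ hj => ?_) (by simp)
    have h := hA i j hj.symm
    rw [← ContinuousLinearMap.star_eq_adjoint] at h
    rw [star_smul, smul_mul_smul_comm, h, smul_zero]
  rw [sq, ← CStarRing.norm_self_mul_star, h1]
  refine (norm_sum_le _ _).trans (le_of_eq ?_)
  refine Finset.sum_congr rfl fun i _ => ?_
  rw [CStarRing.norm_self_mul_star, norm_smul]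
  ring

/-- If `A_i A_j* = 0` for `i ≠ j`, then `‖∑ α_i A_i‖` is bounded by
`(max_i |α_i|)(∑‖A_i‖²)^{1/2}`, by `(∑|α_i|^{2p})^{1/(2p)} (∑‖A_i‖^{2q})^{1/(2q)}`
for conjugate exponents, and by `(∑|α_i|²)^{1/2} max_i ‖A_i‖`. -/
theorem stmt_13 {H : Type*} [NormedAddCommGroup H] [InnerProductSpace ℂ H] [CompleteSpace H]
    (n : ℕ) (hn : 0 < n) (α : Fin n → ℂ) (A : Fin n → H →L[ℂ] H)
    (hA : ∀ i j, i ≠ j → A i * ContinuousLinearMap.adjoint (A j) = 0) :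
    ‖∑ i, α i • A i‖ ≤ (⨆ i, ‖α i‖) * Real.sqrt (∑ i, ‖A i‖ ^ 2) ∧
      (∀ p q : ℝ, 1 < p → 1 / p + 1 / q = 1 →
        ‖∑ i, α i • A i‖ ≤
          (∑ i, ‖α i‖ ^ (2 * p)) ^ (1 / (2 * p)) *
            (∑ i, ‖A i‖ ^ (2 * q)) ^ (1 / (2 * q))) ∧
      ‖∑ i, α i • A i‖ ≤ Real.sqrt (∑ i, ‖α i‖ ^ 2) * ⨆ i, ‖A i‖ := by
  have key := key_aux n α A hA
  refine ⟨?_, ?_, ?_⟩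
  · have hb : ∀ i, ‖α i‖ ≤ ⨆ i, ‖α i‖ := le_ciSup (Set.finite_range _).bddAbove
    have h0 : 0 ≤ ⨆ i, ‖α i‖ := (norm_nonneg _).trans (hb ⟨0, hn⟩)
    refine le_of_sq_le_sq_aux ?_ (by positivity)
    rw [mul_pow, Real.sq_sqrt (by positivity), Finset.mul_sum]
    refine key.trans (Finset.sum_le_sum fun i _ => ?_)
    have := hb i
    gcongr
  · intro p q hp hpq
    have hq : p.HolderConjugate q := by
      rw [Real.holderConjugate_iff]
      exact ⟨hp, by simpa using hpq⟩
    have hp0 := hq.pos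
    have hq0 := hq.symm.pos
    refine le_of_sq_le_sq_aux ?_ (by positivity)
    refine key.trans ((Real.inner_le_Lp_mul_Lq Finset.univ (fun i => ‖α i‖ ^ 2)
      (fun i => ‖A i‖ ^ 2) hq).trans (le_of_eq ?_))
    have e : ∀ (x r : ℝ), 0 ≤ x → |x ^ 2| ^ r = x ^ (2 * r) := by
      intro x r hx
      rw [abs_of_nonneg (by positivity), Real.rpow_mul hx, Real.rpow_two]
    have f : ∀ (x r : ℝ), 0 ≤ x → (x ^ (1 / (2 * r))) ^ 2 = x ^ (1 / r) := by
      intro x r hx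
      rw [← Real.rpow_two, ← Real.rpow_mul hx]
      congr 1
      rw [one_div, mul_inv]
      ring
    simp only [e _ _ (norm_nonneg _)]
    rw [mul_pow, f _ _ (by positivity), f _ _ (by positivity)]
  · have hb : ∀ i, ‖A i‖ ≤ ⨆ i, ‖A i‖ := le_ciSup (Set.finite_range _).bddAbove
    have h0 : 0 ≤ ⨆ i, ‖A i‖ := (norm_nonneg _).trans (hb ⟨0, hn⟩)
    refine le_of_sq_le_sq_aux ?_ (by positivity)
    rw [mul_pow, Real.sq_sqrt (by positivity), Finset.sum_mul]
    refine key.trans (Finset.sum_le_sum fun i _ => ?_)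
    have := hb i
    gcongr
end

section
/- Let α_1,…,α_n be complex numbers, A_1,…,A_n bounded linear operators on a complex Hilbert space H, and x ∈ H. Then ‖∑_{i=1}^n α_i A_i x‖² ≤ ‖x‖² · (max_{1≤i≤n} |α_i|²) · ∑_{i,j=1}^n ‖A_i A_j*‖. -/
/-- `‖∑ α_i A_i x‖² ≤ ‖x‖² (max_i |α_i|²) ∑_{i,j} ‖A_i A_j*‖`. -/
theorem stmt_14 {H : Type*} [NormedAddCommGroup H] [InnerProductSpace ℂ H] [CompleteSpace H]
    (n : ℕ) (hn : 0 < n) (α : Fin n → ℂ) (A : Fin n → H →L[ℂ] H) (x : H) :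
    ‖∑ i, α i • A i x‖ ^ 2 ≤
      ‖x‖ ^ 2 * ((⨆ i, ‖α i‖ ^ 2) *
        ∑ i, ∑ j, ‖A i * ContinuousLinearMap.adjoint (A j)‖) := by
  have hM : ∀ i, ‖α i‖ ^ 2 ≤ ⨆ i, ‖α i‖ ^ 2 := fun i =>
    le_ciSup (f := fun i => ‖α i‖ ^ 2) (Set.finite_range _).bddAbove i
  set M := ⨆ i, ‖α i‖ ^ 2 with hMdef
  let T : H →L[ℂ] H := ∑ i, α i • A i
  have hT : ∑ i, α i • A i x = T x := by simp [T]
  have h1 : ‖T‖ ^ 2 = ‖T * star T‖ := by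
    rw [CStarRing.norm_self_mul_star, sq]
  have h2 : T * star T = ∑ i, ∑ j, (α i * star (α j)) • (A i * star (A j)) := by
    simp only [T, star_sum, star_smul, Finset.sum_mul_sum, smul_mul_smul_comm]
  have h3 : ‖T * star T‖ ≤ M * ∑ i, ∑ j, ‖A i * star (A j)‖ := by
    rw [h2, Finset.mul_sum]
    refine norm_sum_le_of_le _ fun i _ => ?_
    rw [Finset.mul_sum]
    refine norm_sum_le_of_le _ fun j _ => ?_
    rw [norm_smul, norm_mul, norm_star]
    refine mul_le_mul_of_nonneg_right ?_ (norm_nonneg _)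
    nlinarith [hM i, hM j, sq_nonneg (‖α i‖ - ‖α j‖)]
  rw [hT]
  calc ‖T x‖ ^ 2 ≤ (‖T‖ * ‖x‖) ^ 2 := by
        gcongr
        exact T.le_opNorm x
    _ = ‖x‖ ^ 2 * ‖T * star T‖ := by rw [← h1]; ring
    _ ≤ _ := mul_le_mul_of_nonneg_left h3 (sq_nonneg _)
end
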